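/- Let (X, S, μ) be a probability space and let C ⊆ S be a family of measurable sets that is bracketing with respect to μ: for every δ > 0 there exists a finite collection D of measurable sets such that for each C ∈ C there exist U, V ∈ D with U ⊆ C ⊆ V and μ(V \ U) < δ. Then H_μ(C) = 0. -/

import Mathlib

open MeasureTheory Filter

/-- Entropy (base 2) of the join of the sets `C 0, …, C (n-1)`: the cells of the join are
indexed by sign patterns `s : Fin n → Bool`; cells of measure zero contribute `0`. -/
noncomputable def joinEntropy {X : Type*} [MeasurableSpace X] (μ : Measure X)
    {n : ℕ} (C : Fin n → Set X) : ℝ :=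
  ∑ s : Fin n → Bool,
    -((μ (⋂ i, if s i then C i else (C i)ᶜ)).toReal *
      Real.logb 2 (μ (⋂ i, if s i then C i else (C i)ᶜ)).toReal)

/-- Entropy of a family `𝒞` of measurable sets: the supremum over all sequences of sets
from `𝒞` of `liminf (1/n) H_μ(⋁_{i<n} C_i)`. -/
noncomputable def famEntropy {X : Type*} [MeasurableSpace X] (μ : Measure X)
    (𝒞 : Set (Set X)) : ℝ :=
  ⨆ S : {f : ℕ → Set X // ∀ i, f i ∈ 𝒞},
    Filter.liminf (fun n : ℕ => joinEntropy μ (fun i : Fin n => S.1 i) / n) Filter.atTop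

/-- The mean deviation `∫ |(1/n) ∑_{i<n} 1_C(T^i x) − μ(C)| dμ` of the Birkhoff average. -/
noncomputable def birkDev {X : Type*} [MeasurableSpace X] (μ : Measure X)
    (T : X → X) (C : Set X) (n : ℕ) : ℝ :=
  ∫ x, |(∑ i ∈ Finset.range n, C.indicator (fun _ => (1 : ℝ)) (T^[i] x)) / n - (μ C).toReal| ∂μ


lemma gibbs_aux {α : Type*} [Fintype α] (p q : α → ℝ) (hp : ∀ a, 0 ≤ p a) (hq : ∀ a, 0 ≤ q a)
    (hp1 : ∑ a, p a = 1) (hq1 : ∑ a, q a ≤ 1) (hpq : ∀ a, p a ≠ 0 → 0 < q a) :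
    ∑ a, -(p a * Real.log (p a)) ≤ ∑ a, -(p a * Real.log (q a)) := by
  have h : ∀ a, -(p a * Real.log (p a)) - -(p a * Real.log (q a)) ≤ q a - p a := by
    intro a
    by_cases h0 : p a = 0
    · simp [h0, hq a]
    · have hpp : 0 < p a := lt_of_le_of_ne (hp a) (Ne.symm h0)
      have hqp := hpq a h0
      have h1 := Real.log_le_sub_one_of_pos (div_pos hqp hpp)
      rw [Real.log_div hqp.ne' h0] at h1
      have h2 := mul_le_mul_of_nonneg_left h1 hpp.le
      have h3 : p a * (q a / p a - 1) = q a - p a := by field_simp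
      linarith
  have h2 := Finset.sum_le_sum (fun a (_ : a ∈ Finset.univ) => h a)
  rw [Finset.sum_sub_distrib, Finset.sum_sub_distrib] at h2
  linarith

/-- weight -/
noncomputable def wt_aux (u v b : Bool) : ℝ :=
  if u then (if b then 1 else 0) else if v then 1 / 2 else (if b then 0 else 1)

lemma finite_aux {n : ℕ} {D : Type*} [Fintype D] [DecidableEq D] (U V : Fin n → D) (δ : ℝ)
    (r : (Fin n → Bool) → (D → Bool) → ℝ) (hr : ∀ s t, 0 ≤ r s t)
    (hr1 : ∑ s, ∑ t, r s t = 1)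
    (hs : ∀ s t, r s t ≠ 0 → ∀ i, (t (U i) = true → s i = true) ∧ (s i = true → t (V i) = true))
    (hδ : ∀ i, ∑ s, ∑ t, (if t (U i) = false ∧ t (V i) = true then r s t else 0) ≤ δ) :
    ∑ s, -((∑ t, r s t) * Real.log (∑ t, r s t)) ≤
      Real.log (Fintype.card (D → Bool)) + n * (δ * Real.log 2) := by
  set K : ℝ := ((Fintype.card (D → Bool) : ℕ) : ℝ) with hK
  have hKpos : 0 < K := by rw [hK]; exact_mod_cast Fintype.card_pos
  have hw0 : ∀ u v b, 0 ≤ wt_aux u v b := by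
    intro u v b; unfold wt_aux; split_ifs <;> norm_num
  have hw1 : ∀ u v, ∑ b, wt_aux u v b = 1 := by
    intro u v; cases u <;> cases v <;> simp [wt_aux]
  set q : (Fin n → Bool) → ℝ := fun s => K⁻¹ * ∑ t : D → Bool, ∏ i, wt_aux (t (U i)) (t (V i)) (s i)
    with hq
  have hterm0 : ∀ (s : Fin n → Bool) (t : D → Bool),
      0 ≤ ∏ i, wt_aux (t (U i)) (t (V i)) (s i) :=
    fun s t => Finset.prod_nonneg (fun i _ => hw0 _ _ _)
  have hq0 : ∀ s, 0 ≤ q s := fun s =>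
    mul_nonneg (inv_nonneg.2 hKpos.le) (Finset.sum_nonneg (fun t _ => hterm0 s t))
  have hq1 : ∑ s, q s = 1 := by
    simp only [hq]
    rw [← Finset.mul_sum, Finset.sum_comm]
    have : ∀ t : D → Bool, ∑ s : Fin n → Bool, ∏ i, wt_aux (t (U i)) (t (V i)) (s i) = 1 := by
      intro t
      have := Finset.prod_univ_sum (fun _ : Fin n => (Finset.univ : Finset Bool))
        (fun i b => wt_aux (t (U i)) (t (V i)) b)
      rw [Fintype.piFinset_univ] at this
      rw [← this]
      simp only [hw1, Finset.prod_const_one]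
    simp only [this]
    simp only [Finset.sum_const, Finset.card_univ, nsmul_eq_mul, mul_one]
    exact inv_mul_cancel₀ hKpos.ne'
  have hwr : ∀ s t, r s t ≠ 0 → ∀ i, wt_aux (t (U i)) (t (V i)) (s i) =
      if t (U i) = false ∧ t (V i) = true then 1 / 2 else 1 := by
    intro s t h i
    have := hs s t h i
    revert this
    cases t (U i) <;> cases t (V i) <;> cases s i <;> simp [wt_aux]
  have hwpos : ∀ s t, r s t ≠ 0 → 0 < ∏ i, wt_aux (t (U i)) (t (V i)) (s i) := by
    intro s t h
    refine Finset.prod_pos (fun i _ => ?_)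
    rw [hwr s t h i]; split_ifs <;> norm_num
  have hqge : ∀ (s : Fin n → Bool) (t : D → Bool), K⁻¹ * ∏ i, wt_aux (t (U i)) (t (V i)) (s i) ≤ q s := by
    intro s t
    refine mul_le_mul_of_nonneg_left ?_ (inv_nonneg.2 hKpos.le)
    exact Finset.single_le_sum (f := fun t : D → Bool => ∏ i, wt_aux (t (U i)) (t (V i)) (s i))
      (fun t _ => hterm0 s t) (Finset.mem_univ t)
  have hpt : ∀ s t, -(r s t * Real.log (q s)) ≤ r s t * Real.log K +
      ∑ i, (if t (U i) = false ∧ t (V i) = true then r s t else 0) * Real.log 2 := by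
    intro s t
    by_cases h : r s t = 0
    · simp [h]
    · have h1 := Real.log_le_log (mul_pos (inv_pos.2 hKpos) (hwpos s t h)) (hqge s t)
      rw [Real.log_mul (inv_pos.2 hKpos).ne' (hwpos s t h).ne', Real.log_inv,
        Real.log_prod (fun i _ => ?_)] at h1
      · have h2 := mul_le_mul_of_nonneg_left h1 (hr s t)
        have h3 : ∑ i, (if t (U i) = false ∧ t (V i) = true then r s t else 0) * Real.log 2
          = - (r s t * ∑ i, Real.log (wt_aux (t (U i)) (t (V i)) (s i))) := by
          rw [Finset.mul_sum, ← Finset.sum_neg_distrib]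
          refine Finset.sum_congr rfl (fun i _ => ?_)
          rw [hwr s t h i]
          split_ifs
          · rw [one_div, Real.log_inv]; ring
          · simp
        rw [h3]
        nlinarith
      · rw [hwr s t h i]; split_ifs <;> norm_num
  refine (gibbs_aux (fun s => ∑ t, r s t) q (fun s => Finset.sum_nonneg (fun t _ => hr s t)) hq0
    hr1 hq1.le ?_).trans ?_
  · intro s h
    obtain ⟨t, -, ht⟩ := Finset.exists_ne_zero_of_sum_ne_zero h
    exact lt_of_lt_of_le (mul_pos (inv_pos.2 hKpos) (hwpos s t ht)) (hqge s t)
  · calc ∑ s, -((∑ t, r s t) * Real.log (q s)) = ∑ s, ∑ t, -(r s t * Real.log (q s)) := by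
          refine Finset.sum_congr rfl (fun s _ => ?_)
          rw [Finset.sum_mul, Finset.sum_neg_distrib]
      _ ≤ ∑ s, ∑ t, (r s t * Real.log K +
            ∑ i, (if t (U i) = false ∧ t (V i) = true then r s t else 0) * Real.log 2) :=
          Finset.sum_le_sum (fun s _ => Finset.sum_le_sum (fun t _ => hpt s t))
      _ = (∑ s, ∑ t, r s t) * Real.log K + ∑ i, (∑ s, ∑ t,
            (if t (U i) = false ∧ t (V i) = true then r s t else 0)) * Real.log 2 := by
          simp only [Finset.sum_add_distrib, Finset.sum_mul]
          congr 1
          rw [Finset.sum_comm' (t' := Finset.univ) (s' := fun _ => Finset.univ) (by simp)]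
          rw [Finset.sum_comm]
          rw [Finset.sum_comm (γ := Fin n)]
          refine Finset.sum_congr rfl (fun s _ => ?_)
          rw [Finset.sum_comm]
      _ ≤ Real.log K + ∑ i : Fin n, δ * Real.log 2 := by
          rw [hr1, one_mul]
          gcongr with i
          exact hδ i
      _ = _ := by simp

open Classical in
lemma joinEntropy_le_aux {X : Type*} [MeasurableSpace X] (μ : Measure X) [IsProbabilityMeasure μ]
    {n : ℕ} (C : Fin n → Set X) (hC : ∀ i, MeasurableSet (C i)) (δ : ℝ) (D : Finset (Set X))
    (hD : ∀ E ∈ D, MeasurableSet E)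
    (hb : ∀ i, ∃ U ∈ D, ∃ V ∈ D, U ⊆ C i ∧ C i ⊆ V ∧ (μ (V \ U)).toReal < δ) :
    joinEntropy μ C ≤ Real.log (Fintype.card (D → Bool)) / Real.log 2 + n * δ := by
  choose U hU V hV hUC hCV hd using hb
  set f : X → (Fin n → Bool) := fun x i => decide (x ∈ C i) with hf
  set g : X → (D → Bool) := fun x E => decide (x ∈ E.1) with hg
  have hfm : Measurable f := by
    refine measurable_pi_lambda _ (fun i => ?_)
    refine measurable_to_bool ?_
    convert hC i using 1
    ext x; simp [hf]
  have hgm : Measurable g := by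
    refine measurable_pi_lambda _ (fun E => ?_)
    refine measurable_to_bool ?_
    convert hD E.1 E.2 using 1
    ext x; simp [hg]
  have hcell : ∀ s : Fin n → Bool, (⋂ i, if s i then C i else (C i)ᶜ) = f ⁻¹' {s} := by
    intro s
    ext x
    simp only [Set.mem_iInter, Set.mem_preimage, Set.mem_singleton_iff, funext_iff, hf]
    refine forall_congr' (fun i => ?_)
    cases s i <;> simp
  set r : (Fin n → Bool) → (D → Bool) → ℝ := fun s t => μ.real (f ⁻¹' {s} ∩ g ⁻¹' {t}) with hr
  have hms : ∀ s, MeasurableSet (f ⁻¹' {s}) := fun s => hfm (measurableSet_singleton s)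
  have hmt : ∀ t, MeasurableSet (g ⁻¹' {t}) := fun t => hgm (measurableSet_singleton t)
  have hgsum : ∀ A : Set X, MeasurableSet A → ∑ t, μ.real (A ∩ g ⁻¹' {t}) = μ.real A := by
    intro A hA
    have := sum_measureReal_preimage_singleton (μ := μ.restrict A) (f := g) Finset.univ
      (fun t _ => hmt t)
    simp only [measureReal_restrict_apply (hmt _), Finset.coe_univ, Set.preimage_univ,
      measureReal_restrict_apply MeasurableSet.univ, Set.univ_inter] at this
    rw [← this]
    exact Finset.sum_congr rfl (fun t _ => by rw [Set.inter_comm])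
  have hfsum : ∀ A : Set X, MeasurableSet A → ∑ s, μ.real (f ⁻¹' {s} ∩ A) = μ.real A := by
    intro A hA
    have := sum_measureReal_preimage_singleton (μ := μ.restrict A) (f := f) Finset.univ
      (fun t _ => hms t)
    simpa only [measureReal_restrict_apply (hms _), Finset.coe_univ, Set.preimage_univ,
      measureReal_restrict_apply MeasurableSet.univ, Set.univ_inter] using this
  have hrs : ∀ s, ∑ t, r s t = μ.real (f ⁻¹' {s}) := fun s => hgsum _ (hms s)
  have hmain := finite_aux (D := D) (fun i => ⟨U i, hU i⟩) (fun i => ⟨V i, hV i⟩) δ r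
    (fun s t => measureReal_nonneg) ?_ ?_ ?_
  · have hl : 0 < Real.log 2 := Real.log_pos (by norm_num)
    have : joinEntropy μ C = (∑ s, -((∑ t, r s t) * Real.log (∑ t, r s t))) / Real.log 2 := by
      unfold joinEntropy
      rw [Finset.sum_div]
      refine Finset.sum_congr rfl (fun s _ => ?_)
      rw [hcell, hrs, Real.logb, measureReal_def]
      ring
    rw [this, div_le_iff₀ hl]
    refine hmain.trans (le_of_eq ?_)
    field_simp
  · simp only [hrs]
    have := hfsum Set.univ MeasurableSet.univ
    simpa using this
  · intro s t h i
    have hne : (f ⁻¹' {s} ∩ g ⁻¹' {t}).Nonempty := by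
      by_contra hcon
      rw [Set.not_nonempty_iff_eq_empty] at hcon
      exact h (by simp [hr, hcon])
    obtain ⟨x, hx1, hx2⟩ := hne
    simp only [Set.mem_preimage, Set.mem_singleton_iff] at hx1 hx2
    subst hx1 hx2
    simp only [hf, hg, decide_eq_true_eq]
    exact ⟨fun h => hUC i h, fun h => hCV i h⟩
  · intro i
    refine le_trans (le_of_eq ?_) (hd i).le
    have hmUV : MeasurableSet (V i \ U i) := (hD _ (hV i)).diff (hD _ (hU i))
    rw [← measureReal_def, ← hgsum _ hmUV, Finset.sum_comm]
    refine Finset.sum_congr rfl (fun t _ => ?_)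
    split_ifs with h
    · rw [hfsum _ (hmt t)]
      congr 1
      symm
      rw [Set.inter_eq_right]
      intro x hx
      simp only [Set.mem_preimage, Set.mem_singleton_iff] at hx
      subst hx
      simp only [hg, decide_eq_true_eq, decide_eq_false_iff_not] at h
      exact ⟨h.2, h.1⟩
    · rw [Finset.sum_const_zero]
      symm
      convert measureReal_empty (μ := μ)
      rw [Set.eq_empty_iff_forall_notMem]
      rintro x ⟨⟨hx1, hx2⟩, hx⟩
      simp only [Set.mem_preimage, Set.mem_singleton_iff] at hx
      subst hx
      exact h (by simp [hg, hx1, hx2])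

lemma joinEntropy_nonneg_aux {X : Type*} [MeasurableSpace X] (μ : Measure X)
    [IsProbabilityMeasure μ] {n : ℕ} (C : Fin n → Set X) : 0 ≤ joinEntropy μ C := by
  unfold joinEntropy
  refine Finset.sum_nonneg (fun s _ => ?_)
  rw [← measureReal_def, neg_nonneg]
  refine mul_nonpos_of_nonneg_of_nonpos measureReal_nonneg ?_
  exact Real.logb_nonpos (by norm_num) measureReal_nonneg measureReal_le_one

/-- A family of measurable sets that is bracketing with respect to `μ` has zero entropy. -/
theorem zero_entropy_of_bracketing
    {X : Type*} [MeasurableSpace X] (μ : Measure X) [IsProbabilityMeasure μ]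
    (𝒞 : Set (Set X)) (h𝒞 : ∀ C ∈ 𝒞, MeasurableSet C)
    (hbr : ∀ δ > (0 : ℝ), ∃ 𝒟 : Finset (Set X), (∀ D ∈ 𝒟, MeasurableSet D) ∧
      ∀ C ∈ 𝒞, ∃ U ∈ 𝒟, ∃ V ∈ 𝒟, U ⊆ C ∧ C ⊆ V ∧ (μ (V \ U)).toReal < δ) :
    famEntropy μ 𝒞 = 0 := by
  unfold famEntropy
  have key : ∀ S : {f : ℕ → Set X // ∀ i, f i ∈ 𝒞},
      Filter.liminf (fun n : ℕ => joinEntropy μ (fun i : Fin n => S.1 i) / n) Filter.atTop = 0 := by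
    intro S
    refine Filter.Tendsto.liminf_eq ?_
    rw [Metric.tendsto_atTop]
    intro ε hε
    obtain ⟨D, hD, hb⟩ := hbr (ε / 2) (by positivity)
    set L : ℝ := Real.log (Fintype.card (D → Bool)) / Real.log 2 with hL
    obtain ⟨N, hN⟩ := exists_nat_gt (L / (ε / 2))
    refine ⟨N + 1, fun n hn => ?_⟩
    have hn0 : (0 : ℝ) < n := by exact_mod_cast (by omega : 0 < n)
    have hNn : (N : ℝ) ≤ n := by exact_mod_cast (by omega : N ≤ n)
    rw [Real.dist_eq, sub_zero,
      abs_of_nonneg (div_nonneg (joinEntropy_nonneg_aux μ _) hn0.le), div_lt_iff₀ hn0]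
    have h1 := joinEntropy_le_aux μ (fun i : Fin n => S.1 i) (fun i => h𝒞 _ (S.2 i)) (ε / 2) D hD
      (fun i => hb _ (S.2 i))
    rw [div_lt_iff₀ (by positivity)] at hN
    nlinarith
  simp [key]
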